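/- If D is a derivation in PLL (resp. in nuPLL) with conclusion Γ, then its translation D° (resp. D•) is a coderivation in rPLL∞ (resp. in wrPLL∞) with conclusion Γ, and moreover every c!p rule occurring in D° (resp. in D•) belongs to the main branch of a non-wellfounded box. -/

import Mathlib

namespace NWPLL

/-! ## Formulas and sequents -/

inductive Formula : Type where
  | var : ℕ → Formula
  | covar : ℕ → Formula
  | tens : Formula → Formula → Formula
  | parr : Formula → Formula → Formula
  | bang : Formula → Formula
  | quest : Formula → Formula
  | one : Formula
  | bot : Formula
deriving DecidableEq

/-- Linear negation, defined by De Morgan duality. -/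
def Formula.neg : Formula → Formula
  | .var n => .covar n
  | .covar n => .var n
  | .tens A B => .parr A.neg B.neg
  | .parr A B => .tens A.neg B.neg
  | .bang A => .quest A.neg
  | .quest A => .bang A.neg
  | .one => .bot
  | .bot => .one

/-- A sequent is a finite list of formula occurrences. -/
abbrev Sequent := List Formula

/-! ## Rules -/

inductive RuleName : Type where
  | ax | cut | tens | parr | one | bot | qw | qb | cp | fp | hyp | dig
deriving DecidableEq

/-- Canonical instances of the rules (principal formulas at the head,
conclusion of a rule together with the list of its premises, in order). -/
inductive Canon : RuleName → Sequent → List Sequent → Prop where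
  | ax (A : Formula) : Canon .ax [A, A.neg] []
  | cut (A : Formula) (Γ Δ : Sequent) : Canon .cut (Γ ++ Δ) [A :: Γ, A.neg :: Δ]
  | tens (A B : Formula) (Γ Δ : Sequent) :
      Canon .tens (A.tens B :: (Γ ++ Δ)) [A :: Γ, B :: Δ]
  | parr (A B : Formula) (Γ : Sequent) : Canon .parr (A.parr B :: Γ) [A :: B :: Γ]
  | one : Canon .one [.one] []
  | bot (Γ : Sequent) : Canon .bot (.bot :: Γ) [Γ]
  | qw (A : Formula) (Γ : Sequent) : Canon .qw (A.quest :: Γ) [Γ]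
  | qb (A : Formula) (Γ : Sequent) : Canon .qb (A.quest :: Γ) [A :: A.quest :: Γ]
  | cp (A : Formula) (Γ : Sequent) :
      Canon .cp (A.bang :: Γ.map .quest) [A :: Γ, A.bang :: Γ.map .quest]
  | fp (A : Formula) (Γ : Sequent) : Canon .fp (A.bang :: Γ.map .quest) [A :: Γ]
  | hyp (Γ : Sequent) : Canon .hyp Γ []
  | dig (A : Formula) (Γ : Sequent) : Canon .dig (A.quest :: Γ) [A.quest.quest :: Γ]

/-- A rule instance: a canonical instance up to permutation of each sequent
(sequents are lists of occurrences, managed up to exchange). -/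
def RuleOk (r : RuleName) (C : Sequent) (ps : List Sequent) : Prop :=
  ∃ C₀ ps₀, Canon r C₀ ps₀ ∧ C.Perm C₀ ∧ List.Forall₂ List.Perm ps ps₀

/-! ## Coderivations -/

/-- Nodes of a binary tree: `false` = first (left) child, `true` = second (right) child. -/
abbrev Node := List Bool

/-- A (possibly non-wellfounded) coderivation skeleton: a labelling of an
ordered-prefix-closed binary tree by pairs (rule name, sequent). -/
structure Coderivation : Type where
  label : Node → Option (RuleName × Sequent)
  root_isSome : (label []).isSome
  prefix_closed : ∀ v b, (label (v ++ [b])).isSome → (label v).isSome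
  ordered : ∀ v, (label (v ++ [true])).isSome → (label (v ++ [false])).isSome

namespace Coderivation

def mem (D : Coderivation) (v : Node) : Prop := (D.label v).isSome

def ruleAt (D : Coderivation) (v : Node) : Option RuleName := (D.label v).map Prod.fst

def seqAt (D : Coderivation) (v : Node) : Option Sequent := (D.label v).map Prod.snd

def conclusion (D : Coderivation) : Sequent := ((D.label []).map Prod.snd).getD []

/-- The list of premises (sequents of the children) of the rule at node `v`. -/
def premsAt (D : Coderivation) (v : Node) : List Sequent :=
  (D.seqAt (v ++ [false])).toList ++ (D.seqAt (v ++ [true])).toList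

/-- `D` is a coderivation over the set of rules `S`: each node is a valid
instance of a rule of `S`. -/
def IsOver (D : Coderivation) (S : Set RuleName) : Prop :=
  ∀ v r Γ, D.label v = some (r, Γ) → r ∈ S ∧ RuleOk r Γ (D.premsAt v)

def IsFinite (D : Coderivation) : Prop := {v : Node | D.mem v}.Finite

end Coderivation

/-! ## Systems -/

def pllRules : Set RuleName := {.ax, .cut, .tens, .parr, .one, .bot, .qw, .qb, .fp}
def pllInfRules : Set RuleName := {.ax, .cut, .tens, .parr, .one, .bot, .qw, .qb, .cp}
def oPllInfRules : Set RuleName := insert .hyp pllInfRules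
def mellInfRules : Set RuleName := insert .dig pllInfRules

/-- Coderivations of `PLL∞`. -/
def PLLinf (D : Coderivation) : Prop := D.IsOver pllInfRules
/-- Open coderivations (`oPLL∞`). -/
def OPLLinf (D : Coderivation) : Prop := D.IsOver oPllInfRules
/-- Coderivations of `MELL∞` (with digging). -/
def MELLinf (D : Coderivation) : Prop := D.IsOver mellInfRules
/-- Finite derivations of the sequent calculus `PLL` (with functorial promotion). -/
def IsPLLDer (D : Coderivation) : Prop := D.IsOver pllRules ∧ D.IsFinite

/-! ## Branches and global conditions -/

/-- The node at depth `n` along the infinite branch determined by the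
direction function `β`. -/
def brNode (β : ℕ → Bool) (n : ℕ) : Node := (List.range n).map β

def InfBranch (D : Coderivation) (β : ℕ → Bool) : Prop := ∀ n, D.mem (brNode β n)

/-- Weak progressing: every infinite branch goes through the right premise of
a `c!p` rule infinitely often. -/
def WeaklyProg (D : Coderivation) : Prop :=
  ∀ β, InfBranch D β →
    ∀ N, ∃ n, N ≤ n ∧ β n = true ∧ D.ruleAt (brNode β n) = some .cp

/-- Position of the parent (in canonical instances): `childParent r k b p` is
the position in the conclusion of which the formula at position `p` of premise
`b` is the parent; `k` is the length of the first premise. -/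
def childParent : RuleName → ℕ → Bool → ℕ → Option ℕ
  | .cut, _, false, p => if p = 0 then none else some (p - 1)
  | .cut, k, true, p => if p = 0 then none else some (k - 1 + (p - 1))
  | .tens, _, false, p => if p = 0 then some 0 else some p
  | .tens, k, true, p => if p = 0 then some 0 else some (k + (p - 1))
  | .parr, _, false, p => if p ≤ 1 then some 0 else some (p - 1)
  | .bot, _, false, p => some (p + 1)
  | .qw, _, false, p => some (p + 1)
  | .qb, _, false, p => if p = 0 then none else some (p - 1)
  | .cp, _, false, _ => none
  | .cp, _, true, p => some p
  | .fp, _, false, p => some p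
  | .dig, _, false, p => some p
  | _, _, _, _ => none

/-- A position-preserving alignment between a sequent and (a permutation of
it given by) a canonical sequent. -/
def PosAlign (l l' : List Formula) (f : ℕ → ℕ) : Prop :=
  l.length = l'.length ∧
  (∀ i, i < l.length → f i < l'.length ∧ l'[f i]? = l[i]?) ∧
  (∀ i j, i < l.length → j < l.length → f i = f j → i = j)

def bIdx : Bool → ℕ
  | false => 0
  | true => 1

/-- The formula occurrence at position `p` of the premise `b` of the rule at
node `v` is the parent of the occurrence at position `q` of its conclusion. -/
def IsParent (D : Coderivation) (v : Node) (b : Bool) (p q : ℕ) : Prop :=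
  ∃ r C P C₀ P₀ ps₀, ∃ f g : ℕ → ℕ,
    D.label v = some (r, C) ∧ D.seqAt (v ++ [b]) = some P ∧
    Canon r C₀ ps₀ ∧ PosAlign C C₀ f ∧ ps₀[bIdx b]? = some P₀ ∧ PosAlign P P₀ g ∧
    childParent r (ps₀.headD []).length b (g p) = some (f q)

/-- The occurrence at position `q` of the conclusion of the rule at `v` is the
principal `!`-formula of a `c!p` rule. -/
def PrincipalCp (D : Coderivation) (v : Node) (q : ℕ) : Prop :=
  ∃ C C₀ ps₀ f, D.label v = some (.cp, C) ∧ Canon .cp C₀ ps₀ ∧ PosAlign C C₀ f ∧ f q = 0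

def Coderivation.formulaAt (D : Coderivation) (v : Node) (q : ℕ) : Option Formula :=
  (D.seqAt v).bind fun Γ => Γ[q]?

/-- The infinite branch `β` carries a progressing `!`-thread: from some point
on, a sequence of parent-linked `!`-formula occurrences which is infinitely
often principal for a `c!p` rule. -/
def ProgThread (D : Coderivation) (β : ℕ → Bool) : Prop :=
  ∃ k, ∃ t : ℕ → ℕ,
    (∀ i, k ≤ i → ∃ A, D.formulaAt (brNode β i) (t i) = some (Formula.bang A)) ∧
    (∀ i, k ≤ i → IsParent D (brNode β i) (β i) (t (i + 1)) (t i)) ∧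
    (∀ N, ∃ i, N ≤ i ∧ k ≤ i ∧ PrincipalCp D (brNode β i) (t i))

/-- Progressing criterion: every infinite branch carries a progressing `!`-thread. -/
def Progressing (D : Coderivation) : Prop := ∀ β, InfBranch D β → ProgThread D β

/-! ## Basic constructors on coderivations -/

def node0 (r : RuleName) (Γ : Sequent) : Coderivation where
  label w := match w with
    | [] => some (r, Γ)
    | _ :: _ => none
  root_isSome := rfl
  prefix_closed := by
    intro v b h
    match v with
    | [] => exact rfl
    | c :: v' => exact Bool.noConfusion h
  ordered := by
    intro v h
    match v with
    | [] => exact Bool.noConfusion h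
    | c :: v' => exact Bool.noConfusion h

def node1 (r : RuleName) (Γ : Sequent) (D : Coderivation) : Coderivation where
  label w := match w with
    | [] => some (r, Γ)
    | false :: w' => D.label w'
    | true :: _ => none
  root_isSome := rfl
  prefix_closed := by
    intro v b h
    match v with
    | [] => exact rfl
    | false :: v' => exact D.prefix_closed v' b h
    | true :: v' => exact Bool.noConfusion h
  ordered := by
    intro v h
    match v with
    | [] => exact Bool.noConfusion h
    | false :: v' => exact D.ordered v' h
    | true :: v' => exact Bool.noConfusion h

def node2 (r : RuleName) (Γ : Sequent) (D E : Coderivation) : Coderivation where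
  label w := match w with
    | [] => some (r, Γ)
    | false :: w' => D.label w'
    | true :: w' => E.label w'
  root_isSome := rfl
  prefix_closed := by
    intro v b h
    match v with
    | [] => exact rfl
    | false :: v' => exact D.prefix_closed v' b h
    | true :: v' => exact E.prefix_closed v' b h
  ordered := by
    intro v h
    match v with
    | [] => exact D.root_isSome
    | false :: v' => exact D.ordered v' h
    | true :: v' => exact E.ordered v' h

/-- The single-node `hyp` open derivation with conclusion `Γ`. -/
def hypC (Γ : Sequent) : Coderivation := node0 .hyp Γ

/-- The sub-coderivation of `D` rooted at `v` (a default if `v` is not a node of `D`). -/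
def Coderivation.subAt (D : Coderivation) (v : Node) : Coderivation :=
  if h : (D.label v).isSome then
    { label := fun w => D.label (v ++ w)
      root_isSome := by simpa using h
      prefix_closed := by
        intro u b hu
        have hu' : (D.label ((v ++ u) ++ [b])).isSome := by
          rw [List.append_assoc]; exact hu
        exact D.prefix_closed (v ++ u) b hu'
      ordered := by
        intro u hu
        have hu' : (D.label ((v ++ u) ++ [true])).isSome := by
          rw [List.append_assoc]; exact hu
        have h2 := D.ordered (v ++ u) hu'
        show (D.label (v ++ (u ++ [false]))).isSome
        rw [← List.append_assoc]
        exact h2 }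
  else node0 .hyp []

/-! ## Non-wellfounded boxes -/

/-- Splits a node into its number of leading `true`s and, if any, the rest of
the address after the first `false`. -/
def leadSplit : Node → ℕ × Option Node
  | [] => (0, none)
  | true :: w => ((leadSplit w).1 + 1, (leadSplit w).2)
  | false :: w => (0, some w)

lemma leadSplit_append_none (w : Node) (h : (leadSplit w).2 = none) :
    leadSplit (w ++ [true]) = ((leadSplit w).1 + 1, none) ∧
    leadSplit (w ++ [false]) = ((leadSplit w).1, some []) := by
  induction w with
  | nil => exact ⟨rfl, rfl⟩
  | cons c w ih =>
    cases c with
    | false => exact absurd h (by simp [leadSplit])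
    | true =>
      have h' : (leadSplit w).2 = none := by simpa [leadSplit] using h
      obtain ⟨h1, h2⟩ := ih h'
      constructor
      · show leadSplit (true :: (w ++ [true])) = _
        simp [leadSplit, h1]
      · show leadSplit (true :: (w ++ [false])) = _
        simp [leadSplit, h2]

lemma leadSplit_append_some (w u : Node) (h : (leadSplit w).2 = some u) (b : Bool) :
    leadSplit (w ++ [b]) = ((leadSplit w).1, some (u ++ [b])) := by
  induction w with
  | nil => simp [leadSplit] at h
  | cons c w ih =>
    cases c with
    | false =>
      have hw : w = u := by simpa [leadSplit] using h
      subst hw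
      simp [leadSplit]
    | true =>
      have h' : (leadSplit w).2 = some u := by simpa [leadSplit] using h
      have := ih h'
      show leadSplit (true :: (w ++ [b])) = _
      simp [leadSplit, this]

/-- The non-wellfounded box with conclusion `Γ`, whose `i`-th call is `g i`:
its main branch `{ε, 2, 22, …}` consists of `c!p` rules. -/
def nwbOf (Γ : Sequent) (g : ℕ → Coderivation) : Coderivation where
  label w := match (leadSplit w).2 with
    | none => some (.cp, Γ)
    | some u => (g (leadSplit w).1).label u
  root_isSome := rfl
  prefix_closed := by
    intro w b h
    have h' : (match (leadSplit (w ++ [b])).2 with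
      | none => some (RuleName.cp, Γ)
      | some u => (g (leadSplit (w ++ [b])).1).label u).isSome := h
    show (match (leadSplit w).2 with
      | none => some (RuleName.cp, Γ)
      | some u => (g (leadSplit w).1).label u).isSome
    rcases hw : (leadSplit w).2 with _ | u
    · rfl
    · have ha := leadSplit_append_some w u hw b
      rw [ha] at h'
      exact (g (leadSplit w).1).prefix_closed u b h'
  ordered := by
    intro w h
    have h' : (match (leadSplit (w ++ [true])).2 with
      | none => some (RuleName.cp, Γ)
      | some u => (g (leadSplit (w ++ [true])).1).label u).isSome := h
    show (match (leadSplit (w ++ [false])).2 with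
      | none => some (RuleName.cp, Γ)
      | some u => (g (leadSplit (w ++ [false])).1).label u).isSome
    rcases hw : (leadSplit w).2 with _ | u
    · have haf := (leadSplit_append_none w hw).2
      rw [haf]
      exact (g (leadSplit w).1).root_isSome
    · have hat := leadSplit_append_some w u hw true
      have haf := leadSplit_append_some w u hw false
      rw [hat] at h'
      rw [haf]
      exact (g (leadSplit w).1).ordered u h'

/-- The node `v` of `D` is the root of a non-wellfounded box. -/
def IsNwbAt (D : Coderivation) (v : Node) : Prop :=
  ∀ n : ℕ, D.ruleAt (v ++ List.replicate n true) = some .cp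

/-- Every `c!p` rule of `D` belongs to the main branch of a non-wellfounded box. -/
def CpInNwb (D : Coderivation) : Prop :=
  ∀ v, D.ruleAt v = some .cp →
    ∃ w k, v = w ++ List.replicate k true ∧ IsNwbAt D w

/-! ## Regularity and finite expandability -/

def Regular (D : Coderivation) : Prop :=
  {E : Coderivation | ∃ v, D.mem v ∧ E = D.subAt v}.Finite

def WeaklyRegular (D : Coderivation) : Prop :=
  {E : Coderivation | ∃ v, D.ruleAt v = some .cp ∧ E = D.subAt (v ++ [false])}.Finite

def FinExp (D : Coderivation) : Prop :=
  ∀ β, InfBranch D β →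
    {n : ℕ | D.ruleAt (brNode β n) = some .cut ∨ D.ruleAt (brNode β n) = some .qb}.Finite

/-- `rPLL∞`: regular, finitely expandable, progressing coderivations of `PLL∞`. -/
def rPLL (D : Coderivation) : Prop := PLLinf D ∧ Progressing D ∧ FinExp D ∧ Regular D

/-- `wrPLL∞`: weakly regular, finitely expandable, progressing coderivations of `PLL∞`. -/
def wrPLL (D : Coderivation) : Prop := PLLinf D ∧ Progressing D ∧ FinExp D ∧ WeaklyRegular D

def CutFree (D : Coderivation) : Prop := ∀ v, D.ruleAt v ≠ some .cut

/-- No cut-elimination step applies: one premise of each cut is a `hyp`. -/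
def Normal (D : Coderivation) : Prop :=
  ∀ v, D.ruleAt v = some .cut →
    D.ruleAt (v ++ [false]) = some .hyp ∨ D.ruleAt (v ++ [true]) = some .hyp

/-! ## Pruning and approximations -/

lemma prefix_snoc_cases {u v : Node} {x : Bool} (h : u <+: v ++ [x]) :
    u <+: v ∨ u = v ++ [x] := by
  rcases Nat.lt_or_ge u.length (v ++ [x]).length with hl | hl
  · left
    have hle : u.length ≤ v.length := by
      have := hl
      simp only [List.length_append, List.length_cons, List.length_nil] at this
      omega
    exact List.prefix_of_prefix_length_le h (List.prefix_append v [x]) hle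
  · right
    exact h.eq_of_length (le_antisymm h.length_le (le_trans hl (le_of_eq rfl)))

open Classical in
noncomputable def pruneLabel (D : Coderivation) (V : Set Node) (w : Node) :
    Option (RuleName × Sequent) :=
  if ∃ v ∈ V, v <+: w ∧ v ≠ w then none
  else if w ∈ V then (D.label w).map fun p => (.hyp, p.2)
  else D.label w

lemma pruneLabel_isSome {D : Coderivation} {V : Set Node} {w : Node}
    (h : (pruneLabel D V w).isSome) :
    (D.label w).isSome ∧ ¬ ∃ v ∈ V, v <+: w ∧ v ≠ w := by
  classical
  unfold pruneLabel at h
  split_ifs at h with h1 h2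
  · exact absurd h (by simp)
  · exact ⟨by simpa using h, h1⟩
  · exact ⟨h, h1⟩

-- Pruning: replace the sub-coderivations of `D` rooted at the nodes of `V` by `hyp`.
open Classical in
noncomputable def prune (D : Coderivation) (V : Set Node) : Coderivation where
  label := pruneLabel D V
  root_isSome := by
    classical
    unfold pruneLabel
    split_ifs with h1 h2
    · exfalso
      obtain ⟨v, _, hpre, hne⟩ := h1
      exact hne (List.prefix_nil.mp hpre)
    · simpa using D.root_isSome
    · exact D.root_isSome
  prefix_closed := by
    classical
    intro v b h
    obtain ⟨hD, hno⟩ := pruneLabel_isSome h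
    have hDv : (D.label v).isSome := D.prefix_closed v b hD
    have hnov : ¬ ∃ u ∈ V, u <+: v ∧ u ≠ v := by
      rintro ⟨u, hu, hpre, hne⟩
      refine hno ⟨u, hu, hpre.trans (List.prefix_append _ _), fun he => ?_⟩
      have hlen := congrArg List.length he
      have hle : u.length ≤ v.length := hpre.length_le
      simp only [List.length_append, List.length_cons, List.length_nil] at hlen
      omega
    have hvnotV : v ∉ V := by
      intro hv
      refine hno ⟨v, hv, List.prefix_append _ _, fun he => ?_⟩
      have hlen := congrArg List.length he
      simp only [List.length_append, List.length_cons, List.length_nil] at hlen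
      omega
    show (pruneLabel D V v).isSome
    unfold pruneLabel
    rw [if_neg hnov, if_neg hvnotV]
    exact hDv
  ordered := by
    classical
    intro v h
    obtain ⟨hDt, hno⟩ := pruneLabel_isSome h
    have hDf : (D.label (v ++ [false])).isSome := D.ordered v hDt
    have hno' : ¬ ∃ u ∈ V, u <+: v ++ [false] ∧ u ≠ v ++ [false] := by
      rintro ⟨u, hu, hpre, hne⟩
      rcases prefix_snoc_cases hpre with hu_v | heq
      · rcases eq_or_ne u v with rfl | hne'
        · refine hno ⟨u, hu, List.prefix_append _ _, fun he => ?_⟩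
          have hlen := congrArg List.length he
          simp only [List.length_append, List.length_cons, List.length_nil] at hlen
          omega
        · refine hno ⟨u, hu, hu_v.trans (List.prefix_append _ _), fun he => ?_⟩
          have hlen := congrArg List.length he
          have hle : u.length ≤ v.length := hu_v.length_le
          simp only [List.length_append, List.length_cons, List.length_nil] at hlen
          omega
      · exact hne heq
    show (pruneLabel D V (v ++ [false])).isSome
    unfold pruneLabel
    rw [if_neg hno']
    by_cases hmem : v ++ [false] ∈ V
    · rw [if_pos hmem]
      simpa using hDf
    · rw [if_neg hmem]
      exact hDf

/-- `E` approximates `D`: `E` is obtained from `D` by pruning at a set of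
pairwise incomparable nodes. -/
def Approx (E D : Coderivation) : Prop :=
  ∃ V : Set Node, (∀ v ∈ V, ∀ w ∈ V, v <+: w → v = w) ∧ E = prune D V

/-- The greatest cut-free approximation of `D`: prune at the minimal cut nodes. -/
noncomputable def cf (D : Coderivation) : Coderivation :=
  prune D {v | D.ruleAt v = some .cut ∧
    ∀ w, w <+: v → w ≠ v → D.ruleAt w ≠ some .cut}

/-! ## Suprema of countable families of open coderivations -/

open Classical in
noncomputable def chainSupLabel (s : ℕ → Coderivation) (w : Node) :
    Option (RuleName × Sequent) :=
  if h : ∃ i, ((s i).label w).isSome ∧ (s i).ruleAt w ≠ some .hyp then (s h.choose).label w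
  else if h2 : ∃ i, ((s i).label w).isSome then (s h2.choose).label w
  else none

lemma chainSupLabel_isSome (s : ℕ → Coderivation) (w : Node) :
    (chainSupLabel s w).isSome ↔ ∃ i, ((s i).label w).isSome := by
  classical
  unfold chainSupLabel
  split_ifs with h1 h2
  · exact ⟨fun _ => ⟨h1.choose, h1.choose_spec.1⟩, fun _ => h1.choose_spec.1⟩
  · exact ⟨fun _ => h2, fun _ => h2.choose_spec⟩
  · simp [h2]

/-- The supremum of a countable (increasing) family of open coderivations. -/
noncomputable def chainSup (s : ℕ → Coderivation) : Coderivation where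
  label := chainSupLabel s
  root_isSome := (chainSupLabel_isSome s []).mpr ⟨0, (s 0).root_isSome⟩
  prefix_closed := by
    intro v b h
    obtain ⟨i, hi⟩ := (chainSupLabel_isSome s _).mp h
    exact (chainSupLabel_isSome s v).mpr ⟨i, (s i).prefix_closed v b hi⟩
  ordered := by
    intro v h
    obtain ⟨i, hi⟩ := (chainSupLabel_isSome s _).mp h
    exact (chainSupLabel_isSome s _).mpr ⟨i, (s i).ordered v hi⟩

/-! ## Cut elimination steps -/

/-- Iterated weakenings introducing `?Γ` over `E` (of conclusion `Δ`). -/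
def weakAll : List Formula → Sequent → Coderivation → Coderivation
  | [], _, E => E
  | A :: Γ, Δ, E => node1 .qw (A.quest :: (Γ.map .quest ++ Δ)) (weakAll Γ Δ E)

/-- Iterated absorptions absorbing the formulas of `Γ`; the root has conclusion `C`. -/
def absAll : List Formula → Sequent → Coderivation → Coderivation
  | [], _, E => E
  | A :: Γ, C, E => node1 .qb C (absAll Γ (A :: C) E)

/-- Root cut-elimination steps (principal and commutative). -/
inductive StepRoot : Coderivation → Coderivation → Prop where
  | ax (A : Formula) (Δ : Sequent) (E : Coderivation)
      (hE : E.conclusion = A.neg :: Δ) :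
      StepRoot (node2 .cut (A.neg :: Δ) (node0 .ax [A, A.neg]) E) E
  | tens_parr (A B : Formula) (Γ Δ Θ : Sequent) (D E₁ E₂ : Coderivation)
      (hD : D.conclusion = A :: B :: Γ)
      (hE₁ : E₁.conclusion = A.neg :: Δ) (hE₂ : E₂.conclusion = B.neg :: Θ) :
      StepRoot
        (node2 .cut (Γ ++ (Δ ++ Θ))
          (node1 .parr (A.parr B :: Γ) D)
          (node2 .tens (A.neg.tens B.neg :: (Δ ++ Θ)) E₁ E₂))
        (node2 .cut (Γ ++ (Δ ++ Θ))
          (node2 .cut (B :: (Γ ++ Δ)) D E₁) E₂)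
  | one_bot (Γ : Sequent) (D : Coderivation) (hD : D.conclusion = Γ) :
      StepRoot (node2 .cut Γ (node1 .bot (.bot :: Γ) D) (node0 .one [.one])) D
  | cp_cp (A B : Formula) (Γ Δ : Sequent) (D₁ D₂ E₁ E₂ : Coderivation)
      (hD₁ : D₁.conclusion = A :: Γ)
      (hD₂ : D₂.conclusion = A.bang :: Γ.map .quest)
      (hE₁ : E₁.conclusion = B :: A.neg :: Δ)
      (hE₂ : E₂.conclusion = B.bang :: A.neg.quest :: Δ.map .quest) :
      StepRoot
        (node2 .cut (B.bang :: (Γ ++ Δ).map .quest)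
          (node2 .cp (A.bang :: Γ.map .quest) D₁ D₂)
          (node2 .cp (B.bang :: A.neg.quest :: Δ.map .quest) E₁ E₂))
        (node2 .cp (B.bang :: (Γ ++ Δ).map .quest)
          (node2 .cut (B :: (Γ ++ Δ)) D₁ E₁)
          (node2 .cut (B.bang :: (Γ ++ Δ).map .quest) D₂ E₂))
  | cp_qw (A : Formula) (Γ Δ : Sequent) (D₁ D₂ E : Coderivation)
      (hD₁ : D₁.conclusion = A :: Γ)
      (hD₂ : D₂.conclusion = A.bang :: Γ.map .quest)
      (hE : E.conclusion = Δ) :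
      StepRoot
        (node2 .cut (Γ.map .quest ++ Δ)
          (node2 .cp (A.bang :: Γ.map .quest) D₁ D₂)
          (node1 .qw (A.neg.quest :: Δ) E))
        (weakAll Γ Δ E)
  | cp_qb (A : Formula) (Γ Δ : Sequent) (D₁ D₂ E : Coderivation)
      (hD₁ : D₁.conclusion = A :: Γ)
      (hD₂ : D₂.conclusion = A.bang :: Γ.map .quest)
      (hE : E.conclusion = A.neg :: A.neg.quest :: Δ) :
      StepRoot
        (node2 .cut (Γ.map .quest ++ Δ)
          (node2 .cp (A.bang :: Γ.map .quest) D₁ D₂)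
          (node1 .qb (A.neg.quest :: Δ) E))
        (absAll Γ (Γ.map .quest ++ Δ)
          (node2 .cut (Γ ++ (Γ.map .quest ++ Δ)) D₁
            (node2 .cut (A.neg :: (Γ.map .quest ++ Δ)) D₂ E)))
  | fp_fp (A B : Formula) (Γ Δ : Sequent) (D E : Coderivation)
      (hD : D.conclusion = A :: Γ) (hE : E.conclusion = B :: A.neg :: Δ) :
      StepRoot
        (node2 .cut (B.bang :: (Γ ++ Δ).map .quest)
          (node1 .fp (A.bang :: Γ.map .quest) D)
          (node1 .fp (B.bang :: A.neg.quest :: Δ.map .quest) E))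
        (node1 .fp (B.bang :: (Γ ++ Δ).map .quest)
          (node2 .cut (B :: (Γ ++ Δ)) D E))
  | fp_qw (A : Formula) (Γ Δ : Sequent) (D E : Coderivation)
      (hD : D.conclusion = A :: Γ) (hE : E.conclusion = Δ) :
      StepRoot
        (node2 .cut (Γ.map .quest ++ Δ)
          (node1 .fp (A.bang :: Γ.map .quest) D)
          (node1 .qw (A.neg.quest :: Δ) E))
        (weakAll Γ Δ E)
  | fp_qb (A : Formula) (Γ Δ : Sequent) (D E : Coderivation)
      (hD : D.conclusion = A :: Γ) (hE : E.conclusion = A.neg :: A.neg.quest :: Δ) :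
      StepRoot
        (node2 .cut (Γ.map .quest ++ Δ)
          (node1 .fp (A.bang :: Γ.map .quest) D)
          (node1 .qb (A.neg.quest :: Δ) E))
        (absAll Γ (Γ.map .quest ++ Δ)
          (node2 .cut (Γ ++ (Γ.map .quest ++ Δ)) D
            (node2 .cut (A.neg :: (Γ.map .quest ++ Δ))
              (node1 .fp (A.bang :: Γ.map .quest) D) E)))
  | comm1 (r : RuleName) (A : Formula) (Γ Γ' Δ : Sequent) (D E : Coderivation)
      (hr : r ≠ .cut)
      (h1 : RuleOk r (A :: Γ) [A :: Γ'])
      (h2 : RuleOk r (Γ ++ Δ) [Γ' ++ Δ])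
      (hD : D.conclusion = A :: Γ') (hE : E.conclusion = A.neg :: Δ) :
      StepRoot (node2 .cut (Γ ++ Δ) (node1 r (A :: Γ) D) E)
               (node1 r (Γ ++ Δ) (node2 .cut (Γ' ++ Δ) D E))
  | comm2a (r : RuleName) (A : Formula) (Γ Γ₁ Γ₂ Δ : Sequent) (D₁ D₂ E : Coderivation)
      (hr : r ≠ .cut)
      (h1 : RuleOk r (A :: Γ) [A :: Γ₁, Γ₂])
      (h2 : RuleOk r (Γ ++ Δ) [Γ₁ ++ Δ, Γ₂])
      (hD₁ : D₁.conclusion = A :: Γ₁) (hE : E.conclusion = A.neg :: Δ) :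
      StepRoot (node2 .cut (Γ ++ Δ) (node2 r (A :: Γ) D₁ D₂) E)
               (node2 r (Γ ++ Δ) (node2 .cut (Γ₁ ++ Δ) D₁ E) D₂)
  | comm2b (r : RuleName) (A : Formula) (Γ Γ₁ Γ₂ Δ : Sequent) (D₁ D₂ E : Coderivation)
      (hr : r ≠ .cut)
      (h1 : RuleOk r (A :: Γ) [Γ₁, A :: Γ₂])
      (h2 : RuleOk r (Γ ++ Δ) [Γ₁, Γ₂ ++ Δ])
      (hD₂ : D₂.conclusion = A :: Γ₂) (hE : E.conclusion = A.neg :: Δ) :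
      StepRoot (node2 .cut (Γ ++ Δ) (node2 r (A :: Γ) D₁ D₂) E)
               (node2 r (Γ ++ Δ) D₁ (node2 .cut (Γ₂ ++ Δ) D₂ E))
  | comm1r (r : RuleName) (A : Formula) (Γ Δ Δ' : Sequent) (D E : Coderivation)
      (hr : r ≠ .cut)
      (h1 : RuleOk r (A.neg :: Δ) [A.neg :: Δ'])
      (h2 : RuleOk r (Γ ++ Δ) [Γ ++ Δ'])
      (hD : D.conclusion = A :: Γ) (hE : E.conclusion = A.neg :: Δ') :
      StepRoot (node2 .cut (Γ ++ Δ) D (node1 r (A.neg :: Δ) E))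
               (node1 r (Γ ++ Δ) (node2 .cut (Γ ++ Δ') D E))
  | comm2ra (r : RuleName) (A : Formula) (Γ Δ Δ₁ Δ₂ : Sequent) (D E₁ E₂ : Coderivation)
      (hr : r ≠ .cut)
      (h1 : RuleOk r (A.neg :: Δ) [A.neg :: Δ₁, Δ₂])
      (h2 : RuleOk r (Γ ++ Δ) [Γ ++ Δ₁, Δ₂])
      (hD : D.conclusion = A :: Γ) (hE₁ : E₁.conclusion = A.neg :: Δ₁) :
      StepRoot (node2 .cut (Γ ++ Δ) D (node2 r (A.neg :: Δ) E₁ E₂))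
               (node2 r (Γ ++ Δ) (node2 .cut (Γ ++ Δ₁) D E₁) E₂)
  | comm2rb (r : RuleName) (A : Formula) (Γ Δ Δ₁ Δ₂ : Sequent) (D E₁ E₂ : Coderivation)
      (hr : r ≠ .cut)
      (h1 : RuleOk r (A.neg :: Δ) [Δ₁, A.neg :: Δ₂])
      (h2 : RuleOk r (Γ ++ Δ) [Δ₁, Γ ++ Δ₂])
      (hD : D.conclusion = A :: Γ) (hE₂ : E₂.conclusion = A.neg :: Δ₂) :
      StepRoot (node2 .cut (Γ ++ Δ) D (node2 r (A.neg :: Δ) E₁ E₂))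
               (node2 r (Γ ++ Δ) E₁ (node2 .cut (Γ ++ Δ₂) D E₂))

/-- A cut-elimination step performed at node `v`. -/
inductive StepAt : Node → Coderivation → Coderivation → Prop where
  | here {D E : Coderivation} : StepRoot D E → StepAt [] D E
  | in1 {v : Node} {D D' : Coderivation} (r : RuleName) (Γ : Sequent) :
      StepAt v D D' → StepAt (false :: v) (node1 r Γ D) (node1 r Γ D')
  | in2l {v : Node} {D D' : Coderivation} (r : RuleName) (Γ : Sequent) (E : Coderivation) :
      StepAt v D D' → StepAt (false :: v) (node2 r Γ D E) (node2 r Γ D' E)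
  | in2r {v : Node} {E E' : Coderivation} (r : RuleName) (Γ : Sequent) (D : Coderivation) :
      StepAt v E E' → StepAt (true :: v) (node2 r Γ D E) (node2 r Γ D E')

/-- One step of cut elimination. -/
def Step (D E : Coderivation) : Prop := ∃ v, StepAt v D E

/-! ## Infinitary cut-elimination strategies -/

/-- Upper bound for the approximation order. -/
def IsUB (S : Set Coderivation) (u : Coderivation) : Prop := ∀ x ∈ S, Approx x u

/-- Least upper bound for the approximation order. -/
def IsLubA (S : Set Coderivation) (u : Coderivation) : Prop :=
  IsUB S u ∧ ∀ w, IsUB S w → Approx u w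

/-- Scott continuity with respect to the approximation order. -/
def ScottCont (f : Coderivation → Coderivation) : Prop :=
  (∀ D E, Approx D E → Approx (f D) (f E)) ∧
  ∀ S u, S.Nonempty → DirectedOn Approx S → IsLubA S u → IsLubA (f '' S) (f u)

/-- An infinitary cut-elimination strategy: for each open coderivation `D`, a
reduction sequence `σ_D` of length `len D ≤ ω`, starting at `D`, performing a
cut-elimination step at each stage, and constant after `len D`. -/
structure Ices where
  seq : Coderivation → ℕ → Coderivation
  len : Coderivation → ℕ∞
  seq_zero : ∀ D, seq D 0 = D
  seq_step : ∀ D (i : ℕ), (i : ℕ∞) < len D → Step (seq D i) (seq D (i + 1))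
  seq_stable : ∀ D (i : ℕ), len D ≤ (i : ℕ∞) → seq D (i + 1) = seq D i

/-- The function computed by an ices: the supremum of the greatest cut-free
approximations along the reduction sequence. -/
noncomputable def fIces (σ : Ices) (D : Coderivation) : Coderivation :=
  chainSup fun i => cf (σ.seq D i)

/-- Maximality: on (finite) open derivations the strategy reaches a normal form. -/
def Ices.Maximal (σ : Ices) : Prop :=
  ∀ D, OPLLinf D → D.IsFinite → ∃ n : ℕ, σ.len D = (n : ℕ∞) ∧ Normal (σ.seq D n)

/-- Maximal and continuous infinitary cut-elimination strategy (mc-ices). -/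
def Ices.IsMc (σ : Ices) : Prop := σ.Maximal ∧ ScottCont (fIces σ)

/-! ## The height-by-height strategy -/

/-- Code of a node: smaller codes mean smaller height, and for equal heights,
more to the left. -/
def nodeCode (v : Node) : ℕ := v.foldl (fun n b => 2 * n + cond b 1 0) 1

open Classical in
noncomputable def hbhNext (D : Coderivation) : Coderivation :=
  if h : ∃ n, ∃ v E, StepAt v D E ∧ nodeCode v = n then
    (Nat.find_spec h).choose_spec.choose
  else D

/-- The height-by-height reduction sequence: at each stage, one cut-elimination
step is applied to the leftmost reducible cut of minimal height. -/
noncomputable def hbhSeq (D : Coderivation) : ℕ → Coderivation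
  | 0 => D
  | n + 1 => hbhNext (hbhSeq D n)

/-- `f_{σ∞}`, the function computed by the height-by-height strategy. -/
noncomputable def fHbh (D : Coderivation) : Coderivation :=
  chainSup fun i => cf (hbhSeq D i)

/-! ## The Scott domain of open coderivations -/

/-- Open coderivations with conclusion `Γ`. -/
def Dom (Γ : Sequent) : Set Coderivation := {D | OPLLinf D ∧ D.conclusion = Γ}

def IsLubOn (Γ : Sequent) (S : Set Coderivation) (u : Coderivation) : Prop :=
  u ∈ Dom Γ ∧ IsUB S u ∧ ∀ w ∈ Dom Γ, IsUB S w → Approx u w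

/-- Compactness in the domain of open coderivations with conclusion `Γ`. -/
def CompactOn (Γ : Sequent) (x : Coderivation) : Prop :=
  ∀ S, S ⊆ Dom Γ → S.Nonempty → DirectedOn Approx S →
    ∀ u, IsLubOn Γ S u → Approx x u → ∃ y ∈ S, Approx x y

/-- Maximality in the domain of open coderivations with conclusion `Γ`. -/
def MaxOn (Γ : Sequent) (x : Coderivation) : Prop :=
  ∀ y ∈ Dom Γ, Approx x y → x = y

/-! ## Relational semantics -/

/-- Codes for points of the relational model (`D_X := ℕ` for each variable):
`uStar` interprets units, `uEl` elements of the web of a variable, `uPair`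
pairs, `uMSet` finite multisets. -/
def uStar : ℕ := Nat.pair 0 0
def uEl (n : ℕ) : ℕ := Nat.pair 1 n
def uPair (a b : ℕ) : ℕ := Nat.pair 2 (Nat.pair a b)
noncomputable def uMSet (m : Multiset ℕ) : ℕ := Nat.pair 3 (Encodable.encode m)

/-- The web of a formula. -/
noncomputable def semF : Formula → Set ℕ
  | .var _ => Set.range uEl
  | .covar _ => Set.range uEl
  | .one => {uStar}
  | .bot => {uStar}
  | .tens A B => {x | ∃ a ∈ semF A, ∃ b ∈ semF B, x = uPair a b}
  | .parr A B => {x | ∃ a ∈ semF A, ∃ b ∈ semF B, x = uPair a b}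
  | .bang A => {x | ∃ m : Multiset ℕ, (∀ a ∈ m, a ∈ semF A) ∧ x = uMSet m}
  | .quest A => {x | ∃ m : Multiset ℕ, (∀ a ∈ m, a ∈ semF A) ∧ x = uMSet m}

/-- Pointwise merge of a tuple of elements into a tuple of multisets. -/
inductive MergeM : List ℕ → List ℕ → List ℕ → Prop where
  | nil : MergeM [] [] []
  | cons (x : ℕ) (m : Multiset ℕ) {xs ms ts : List ℕ} :
      MergeM xs ms ts → MergeM (x :: xs) (uMSet m :: ms) (uMSet (x ::ₘ m) :: ts)

/-- Transport of a tuple along a position alignment. -/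
def AlignedTuple (f : ℕ → ℕ) (t t₀ : List ℕ) : Prop :=
  t.length = t₀.length ∧ ∀ i, i < t.length → t₀[f i]? = t[i]?

/-- The semantic clause of each rule, on canonical instances; `S b` is the
(already transported) interpretation of premise `b`. -/
noncomputable def CanonSem : RuleName → Sequent → (Bool → Set (List ℕ)) → Set (List ℕ)
  | .ax, C₀, _ => {t | ∃ A x, C₀ = [A, A.neg] ∧ x ∈ semF A ∧ t = [x, x]}
  | .cut, _, S => {t | ∃ z u v, (z :: u) ∈ S false ∧ (z :: v) ∈ S true ∧ t = u ++ v}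
  | .tens, _, S =>
      {t | ∃ a b u v, (a :: u) ∈ S false ∧ (b :: v) ∈ S true ∧ t = uPair a b :: (u ++ v)}
  | .parr, _, S => {t | ∃ a b u, (a :: b :: u) ∈ S false ∧ t = uPair a b :: u}
  | .one, _, _ => {[uStar]}
  | .bot, _, S => {t | ∃ u ∈ S false, t = uStar :: u}
  | .qw, _, S => {t | ∃ u ∈ S false, t = uMSet 0 :: u}
  | .qb, _, S =>
      {t | ∃ y, ∃ μ : Multiset ℕ, ∃ u, (y :: uMSet μ :: u) ∈ S false ∧ t = uMSet (y ::ₘ μ) :: u}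
  | .cp, C₀, S =>
      {t | t = List.replicate C₀.length (uMSet 0)} ∪
      {t | ∃ x xs m ms ts, (x :: xs) ∈ S false ∧ (uMSet m :: ms) ∈ S true ∧
        MergeM xs ms ts ∧ t = uMSet (x ::ₘ m) :: ts}
  | .dig, _, S =>
      {t | ∃ ms : List (Multiset ℕ), ∃ u,
        (uMSet ((ms.map uMSet : List ℕ) : Multiset ℕ) :: u) ∈ S false ∧
        t = uMSet ms.sum :: u}
  | _, _, _ => ∅

/-- The `n`-th finite stage of the relational interpretation of a coderivation. -/
noncomputable def interpN : ℕ → Coderivation → Set (List ℕ)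
  | 0, _ => ∅
  | n + 1, D =>
    {t | ∃ r C C₀ ps₀ f t₀,
      D.label [] = some (r, C) ∧ Canon r C₀ ps₀ ∧ PosAlign C C₀ f ∧
      AlignedTuple f t t₀ ∧
      t₀ ∈ CanonSem r C₀ (fun b =>
        {u₀ | ∃ P P₀ g u, D.seqAt [b] = some P ∧ ps₀[bIdx b]? = some P₀ ∧
          PosAlign P P₀ g ∧ AlignedTuple g u u₀ ∧ u ∈ interpN n (D.subAt [b])})}

/-- The relational interpretation `⟦D⟧` of a coderivation. -/
noncomputable def interp (D : Coderivation) : Set (List ℕ) := ⋃ n, interpN n D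

/-! ## Finite (wellfounded) derivations of `PLL` and `nuPLL`, and their translations -/

/-- Finite derivation trees (for `PLL`). -/
inductive PDeriv : Type where
  | p0 (r : RuleName) (Γ : Sequent) : PDeriv
  | p1 (r : RuleName) (Γ : Sequent) (D : PDeriv) : PDeriv
  | p2 (r : RuleName) (Γ : Sequent) (D E : PDeriv) : PDeriv

def PDeriv.concl : PDeriv → Sequent
  | .p0 _ Γ => Γ
  | .p1 _ Γ _ => Γ
  | .p2 _ Γ _ _ => Γ

/-- Valid derivations of the sequent calculus `PLL`. -/
inductive PValid : PDeriv → Prop where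
  | p0 (r : RuleName) (Γ : Sequent) :
      r ∈ pllRules → RuleOk r Γ [] → PValid (.p0 r Γ)
  | p1 (r : RuleName) (Γ : Sequent) (D : PDeriv) :
      r ∈ pllRules → RuleOk r Γ [D.concl] → PValid D → PValid (.p1 r Γ D)
  | p2 (r : RuleName) (Γ : Sequent) (D E : PDeriv) :
      r ∈ pllRules → RuleOk r Γ [D.concl, E.concl] → PValid D → PValid E →
      PValid (.p2 r Γ D E)

/-- The translation `(·)° : PLL → PLL∞`, unfolding each functorial promotion
into a non-wellfounded box all of whose calls are equal. -/
def PDeriv.toCo : PDeriv → Coderivation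
  | .p0 r Γ => node0 r Γ
  | .p1 r Γ D => if r = .fp then nwbOf Γ (fun _ => D.toCo) else node1 r Γ D.toCo
  | .p2 r Γ D E => node2 r Γ D.toCo E.toCo

/-- Wellfounded, infinitely-branching derivation trees (for `nuPLL`). -/
inductive NDeriv : Type where
  | n0 (r : RuleName) (Γ : Sequent) : NDeriv
  | n1 (r : RuleName) (Γ : Sequent) (D : NDeriv) : NDeriv
  | n2 (r : RuleName) (Γ : Sequent) (D E : NDeriv) : NDeriv
  | nup (Γ : Sequent) (f : ℕ → NDeriv) : NDeriv

def NDeriv.concl : NDeriv → Sequent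
  | .n0 _ Γ => Γ
  | .n1 _ Γ _ => Γ
  | .n2 _ Γ _ _ => Γ
  | .nup Γ _ => Γ

def nupllRules : Set RuleName := {.ax, .cut, .tens, .parr, .one, .bot, .qw, .qb}

/-- Valid derivations of `nuPLL`: the infinitely branching promotion `ν!p` has
countably many premises with the same conclusion, finitely many of which are
distinct. -/
inductive NValid : NDeriv → Prop where
  | n0 (r : RuleName) (Γ : Sequent) :
      r ∈ nupllRules → RuleOk r Γ [] → NValid (.n0 r Γ)
  | n1 (r : RuleName) (Γ : Sequent) (D : NDeriv) :
      r ∈ nupllRules → RuleOk r Γ [D.concl] → NValid D → NValid (.n1 r Γ D)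
  | n2 (r : RuleName) (Γ : Sequent) (D E : NDeriv) :
      r ∈ nupllRules → RuleOk r Γ [D.concl, E.concl] → NValid D → NValid E →
      NValid (.n2 r Γ D E)
  | nup (Γ : Sequent) (f : ℕ → NDeriv) :
      (∀ i, NValid (f i)) → (Set.range f).Finite →
      (∀ i, (f i).concl = (f 0).concl) →
      RuleOk .fp Γ [(f 0).concl] →
      NValid (.nup Γ f)

/-- The translation `(·)• : nuPLL → PLL∞`, unfolding each `ν!p` with premises
`(D_i)` into the non-wellfounded box whose `i`-th call is `D_i•`. -/
def NDeriv.toCo : NDeriv → Coderivation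
  | .n0 r Γ => node0 r Γ
  | .n1 r Γ D => node1 r Γ D.toCo
  | .n2 r Γ D E => node2 r Γ D.toCo E.toCo
  | .nup Γ f => nwbOf Γ (fun i => (f i).toCo)

/-! ## The digging counterexample -/

def fX : Formula := .var 0

/-- `N := !(X ⊸ X) ⊸ X ⊸ X = ?(X ⊗ X^⊥) ⅋ (X^⊥ ⅋ X)`. -/
def fN : Formula := (Formula.quest (fX.tens fX.neg)).parr (fX.neg.parr fX)

/-- The derivation `0` of `⊢ N` (weakening over an axiom). -/
def cod0 : Coderivation :=
  node1 .parr [fN]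
    (node1 .parr [.quest (fX.tens fX.neg), fX.neg.parr fX]
      (node1 .qw [.quest (fX.tens fX.neg), fX.neg, fX]
        (node0 .ax [fX.neg, fX])))

/-- The derivation `1` of `⊢ N` (absorption over a weakened tensor of axioms). -/
def cod1 : Coderivation :=
  node1 .parr [fN]
    (node1 .parr [.quest (fX.tens fX.neg), fX.neg.parr fX]
      (node1 .qb [.quest (fX.tens fX.neg), fX.neg, fX]
        (node1 .qw [fX.tens fX.neg, .quest (fX.tens fX.neg), fX.neg, fX]
          (node2 .tens [fX.tens fX.neg, fX.neg, fX]
            (node0 .ax [fX, fX.neg])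
            (node0 .ax [fX.neg, fX])))))

/-- The non-wellfounded box `⟨0,1,0,1,…⟩` of conclusion `⊢ !N`. -/
def boxAlt : Coderivation := nwbOf [fN.bang] fun i => if i % 2 = 0 then cod0 else cod1

/-- Digging applied to the axiom `⊢ ??N^⊥, !!N`. -/
def digCo : Coderivation :=
  node1 .dig [fN.neg.quest, fN.bang.bang]
    (node0 .ax [fN.neg.quest.quest, fN.bang.bang])

/-- The coderivation `D_??d` of `⊢ !!N`. -/
def Ddig : Coderivation := node2 .cut [fN.bang.bang] boxAlt digCo

/-! ## Positions along permutations -/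

lemma PosAlign.exists_of_perm {l l' : List Formula} (h : l.Perm l') :
    ∃ f, PosAlign l l' f ∧ ∀ j, j < l'.length → ∃ i, i < l.length ∧ f i = j := by
  induction h with
  | nil => exact ⟨id, ⟨rfl, by simp, by simp⟩, by simp⟩
  | cons x h ih =>
    obtain ⟨f, ⟨h1, h2, h3⟩, h4⟩ := ih
    refine ⟨fun i => match i with | 0 => 0 | i + 1 => f i + 1, ⟨by simp [h1], ?_, ?_⟩, ?_⟩
    · rintro (_ | i) hi
      · simp
      · simpa using h2 i (by simpa using hi)
    · rintro (_ | i) (_ | j) hi hj hij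
      · rfl
      · simp at hij
      · simp at hij
      · simpa using h3 i j (by simpa using hi) (by simpa using hj) (by simpa using hij)
    · rintro (_ | j) hj
      · exact ⟨0, by simp, rfl⟩
      · obtain ⟨i, hi, rfl⟩ := h4 j (by simpa using hj)
        exact ⟨i + 1, by simpa using hi, rfl⟩
  | swap x y l =>
    refine ⟨fun i => match i with | 0 => 1 | 1 => 0 | i + 2 => i + 2, ⟨by simp, ?_, ?_⟩, ?_⟩
    · rintro (_ | _ | i) hi
      · simp
      · simp
      · simpa using hi
    · rintro (_ | _ | i) (_ | _ | j) hi hj hij <;> simp_all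
    · rintro (_ | _ | j) hj
      · exact ⟨1, by simp, rfl⟩
      · exact ⟨0, by simp, rfl⟩
      · exact ⟨j + 2, by simpa using hj, rfl⟩
  | trans _ _ ih₁ ih₂ =>
    obtain ⟨f, ⟨f1, f2, f3⟩, f4⟩ := ih₁
    obtain ⟨g, ⟨g1, g2, g3⟩, g4⟩ := ih₂
    refine ⟨g ∘ f, ⟨f1.trans g1, fun i hi => ?_, fun i j hi hj hij => ?_⟩, fun k hk => ?_⟩
    · exact ⟨(g2 _ (f2 i hi).1).1, (g2 _ (f2 i hi).1).2.trans (f2 i hi).2⟩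
    · exact f3 i j hi hj (g3 _ _ (f2 i hi).1 (f2 j hj).1 hij)
    · obtain ⟨j, hj, rfl⟩ := g4 k hk
      obtain ⟨i, hi, rfl⟩ := f4 j hj
      exact ⟨i, hi, rfl⟩

/-! ## Branches -/

lemma length_brNode (β : ℕ → Bool) (n : ℕ) : (brNode β n).length = n := by simp [brNode]

lemma brNode_add (β : ℕ → Bool) (n m : ℕ) :
    brNode β (n + m) = brNode β n ++ brNode (fun k => β (n + k)) m := by
  simp [brNode, List.range_add, Function.comp_def]

lemma brNode_succ (β : ℕ → Bool) (n : ℕ) : brNode β (n + 1) = brNode β n ++ [β n] := by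
  simp [brNode, List.range_succ]

lemma brNode_eq_of_append {β : ℕ → Bool} {n : ℕ} {u w : Node} (h : brNode β n = u ++ w) :
    brNode β u.length = u := by
  have hn : n = u.length + w.length := by
    simpa [length_brNode] using congrArg List.length h
  rw [hn, brNode_add] at h
  exact (List.append_inj h (length_brNode _ _)).1

lemma brNode_eq_replicate {β : ℕ → Bool}
    (h : ∀ n, ∃ m, brNode β n = List.replicate m true) (n : ℕ) :
    brNode β n = List.replicate n true := by
  obtain ⟨m, hm⟩ := h n
  have : n = m := by simpa [length_brNode] using congrArg List.length hm
  rw [hm, this]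

/-! ## Embedded sub-coderivations -/

namespace Coderivation

lemma ext_label {D E : Coderivation} (h : ∀ w, D.label w = E.label w) : D = E := by
  cases D; cases E
  congr
  exact funext h

/-- The part of `D` above the node `u` is `E`. -/
def HasSub (D : Coderivation) (u : Node) (E : Coderivation) : Prop :=
  ∀ w, D.label (u ++ w) = E.label w

namespace HasSub

variable {D E : Coderivation} {u : Node}

lemma seqAt (h : D.HasSub u E) (w : Node) : D.seqAt (u ++ w) = E.seqAt w := by
  simp only [Coderivation.seqAt, h w]

lemma ruleAt (h : D.HasSub u E) (w : Node) : D.ruleAt (u ++ w) = E.ruleAt w := by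
  simp only [Coderivation.ruleAt, h w]

lemma mem_iff (h : D.HasSub u E) (w : Node) : D.mem (u ++ w) ↔ E.mem w := by
  simp only [Coderivation.mem, h w]

lemma premsAt (h : D.HasSub u E) (w : Node) : D.premsAt (u ++ w) = E.premsAt w := by
  simp only [Coderivation.premsAt, List.append_assoc, h.seqAt]

lemma seqAt_root (h : D.HasSub u E) : D.seqAt u = some E.conclusion := by
  have h0 := h []
  obtain ⟨x, hx⟩ := Option.isSome_iff_exists.1 E.root_isSome
  simp only [List.append_nil] at h0
  simp [Coderivation.seqAt, conclusion, h0, hx]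

lemma subAt_append (h : D.HasSub u E) (w : Node) : D.subAt (u ++ w) = E.subAt w := by
  apply ext_label
  intro x
  unfold Coderivation.subAt
  by_cases hw : (E.label w).isSome
  · have hw' : (D.label (u ++ w)).isSome := by rw [h w]; exact hw
    rw [dif_pos hw, dif_pos hw']
    simp only [List.append_assoc, h (w ++ x)]
  · have hw' : ¬ (D.label (u ++ w)).isSome := by rw [h w]; exact hw
    rw [dif_neg hw, dif_neg hw']

lemma subAt_eq (h : D.HasSub u E) : D.subAt u = E := by
  apply ext_label
  intro x
  have hu : (D.label u).isSome := by
    have h0 := h []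
    rw [List.append_nil] at h0
    rw [h0]
    exact E.root_isSome
  unfold Coderivation.subAt
  rw [dif_pos hu]
  exact h x

lemma isParent (h : D.HasSub u E) {w : Node} {b : Bool} {p q : ℕ} (hp : IsParent E w b p q) :
    IsParent D (u ++ w) b p q := by
  unfold IsParent at hp ⊢
  simpa only [List.append_assoc, h w, h.seqAt] using hp

lemma principalCp (h : D.HasSub u E) {w : Node} {q : ℕ} (hp : PrincipalCp E w q) :
    PrincipalCp D (u ++ w) q := by
  unfold PrincipalCp at hp ⊢
  simpa only [h w] using hp

lemma formulaAt (h : D.HasSub u E) (w : Node) (q : ℕ) :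
    D.formulaAt (u ++ w) q = E.formulaAt w q := by
  simp only [Coderivation.formulaAt, h.seqAt]

lemma brNode_add {β : ℕ → Bool} (hu : brNode β u.length = u) (m : ℕ) :
    brNode β (u.length + m) = u ++ brNode (fun k => β (u.length + k)) m := by
  rw [NWPLL.brNode_add, hu]

lemma infBranch (h : D.HasSub u E) {β : ℕ → Bool} (hu : brNode β u.length = u)
    (hβ : InfBranch D β) : InfBranch E fun k => β (u.length + k) := by
  intro m
  rw [← h.mem_iff, ← brNode_add hu]
  exact hβ _

lemma progThread (h : D.HasSub u E) {β : ℕ → Bool} (hu : brNode β u.length = u)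
    (ht : ProgThread E fun k => β (u.length + k)) : ProgThread D β := by
  obtain ⟨k, t, h1, h2, h3⟩ := ht
  refine ⟨u.length + k, fun i => t (i - u.length), fun i hi => ?_, fun i hi => ?_, fun N => ?_⟩
  · obtain ⟨j, rfl⟩ := Nat.exists_eq_add_of_le (Nat.le_of_add_right_le hi)
    simp only [brNode_add hu, h.formulaAt, Nat.add_sub_cancel_left]
    exact h1 j (by omega)
  · obtain ⟨j, rfl⟩ := Nat.exists_eq_add_of_le (Nat.le_of_add_right_le hi)
    simp only [brNode_add hu, Nat.add_assoc, Nat.add_sub_cancel_left]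
    exact h.isParent (h2 j (by omega))
  · obtain ⟨i, hN, hk, hi⟩ := h3 N
    refine ⟨u.length + i, by omega, by omega, ?_⟩
    simp only [brNode_add hu, Nat.add_sub_cancel_left]
    exact h.principalCp hi

lemma finite_cut_qb (h : D.HasSub u E) {β : ℕ → Bool} (hu : brNode β u.length = u)
    (hβ : InfBranch D β) (hE : FinExp E) :
    {n | D.ruleAt (brNode β n) = some .cut ∨ D.ruleAt (brNode β n) = some .qb}.Finite := by
  refine ((Set.finite_lt_nat u.length).union
    ((hE _ (h.infBranch hu hβ)).image (u.length + ·))).subset fun n hn => ?_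
  rcases lt_or_ge n u.length with hlt | hge
  · exact Or.inl hlt
  · obtain ⟨j, rfl⟩ := Nat.exists_eq_add_of_le hge
    rw [Set.mem_ofPred_eq, brNode_add hu, h.ruleAt] at hn
    exact Or.inr ⟨j, hn, rfl⟩

end HasSub

end Coderivation

/-! ## Assembling coderivations -/

section Assembly

variable {D : Coderivation} {ι : Type} {u : ι → Node} {E : ι → Coderivation}

/-- A node below all the sub-coderivations placed at the nodes `u i`. -/
def IsTop (u : ι → Node) (v : Node) : Prop := ∀ i w, v ≠ u i ++ w

lemma IsTop.cases (u : ι → Node) (v : Node) : IsTop u v ∨ ∃ i w, v = u i ++ w := by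
  by_cases h : IsTop u v
  · exact Or.inl h
  · simp only [IsTop, not_forall, not_not] at h
    exact Or.inr h

lemma isOver_of_hasSub {S : Set RuleName} (h : ∀ i, D.HasSub (u i) (E i))
    (hE : ∀ i, (E i).IsOver S)
    (ht : ∀ v r Γ, IsTop u v → D.label v = some (r, Γ) → r ∈ S ∧ RuleOk r Γ (D.premsAt v)) :
    D.IsOver S := by
  intro v r Γ hv
  rcases IsTop.cases u v with hT | ⟨i, w, rfl⟩
  · exact ht v r Γ hT hv
  · rw [(h i).premsAt]
    exact hE i w r Γ (by rw [← h i w, hv])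

lemma progressing_of_hasSub (h : ∀ i, D.HasSub (u i) (E i)) (hE : ∀ i, Progressing (E i))
    (ht : ∀ β, InfBranch D β → (∀ n, IsTop u (brNode β n)) → ProgThread D β) :
    Progressing D := by
  intro β hβ
  by_cases hT : ∀ n, IsTop u (brNode β n)
  · exact ht β hβ hT
  · obtain ⟨n, hn⟩ := not_forall.1 hT
    obtain ⟨i, w, hw⟩ := (IsTop.cases u _).resolve_left hn
    have hu := brNode_eq_of_append hw
    exact (h i).progThread hu (hE i _ ((h i).infBranch hu hβ))

lemma finExp_of_hasSub (h : ∀ i, D.HasSub (u i) (E i)) (hE : ∀ i, FinExp (E i))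
    (ht : ∀ β, InfBranch D β → (∀ n, IsTop u (brNode β n)) →
      {n | D.ruleAt (brNode β n) = some .cut ∨ D.ruleAt (brNode β n) = some .qb}.Finite) :
    FinExp D := by
  intro β hβ
  by_cases hT : ∀ n, IsTop u (brNode β n)
  · exact ht β hβ hT
  · obtain ⟨n, hn⟩ := not_forall.1 hT
    obtain ⟨i, w, hw⟩ := (IsTop.cases u _).resolve_left hn
    exact (h i).finite_cut_qb (brNode_eq_of_append hw) hβ (hE i)

lemma cpInNwb_of_hasSub (h : ∀ i, D.HasSub (u i) (E i)) (hE : ∀ i, CpInNwb (E i))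
    (ht : ∀ v, IsTop u v → D.ruleAt v = some .cp →
      ∃ w k, v = w ++ List.replicate k true ∧ IsNwbAt D w) :
    CpInNwb D := by
  intro v hv
  rcases IsTop.cases u v with hT | ⟨i, w, rfl⟩
  · exact ht v hT hv
  · rw [(h i).ruleAt] at hv
    obtain ⟨x, k, rfl, hx⟩ := hE i w hv
    refine ⟨u i ++ x, k, (List.append_assoc ..).symm, fun n => ?_⟩
    rw [List.append_assoc, (h i).ruleAt]
    exact hx n

lemma regular_of_hasSub (h : ∀ i, D.HasSub (u i) (E i)) (hfin : (Set.range E).Finite)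
    (hE : ∀ i, Regular (E i))
    (ht : {F | ∃ v, IsTop u v ∧ D.mem v ∧ F = D.subAt v}.Finite) : Regular D := by
  have hU : (⋃ F ∈ Set.range E, {G : Coderivation | ∃ v, F.mem v ∧ G = F.subAt v}).Finite :=
    hfin.biUnion (by rintro _ ⟨i, rfl⟩; exact hE i)
  refine (ht.union hU).subset ?_
  rintro F ⟨v, hv, rfl⟩
  rcases IsTop.cases u v with hT | ⟨i, w, rfl⟩
  · exact Or.inl ⟨v, hT, hv, rfl⟩
  · rw [(h i).mem_iff] at hv
    exact Or.inr (Set.mem_biUnion (Set.mem_range_self i) ⟨w, hv, (h i).subAt_append w⟩)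

lemma weaklyRegular_of_hasSub (h : ∀ i, D.HasSub (u i) (E i)) (hfin : (Set.range E).Finite)
    (hE : ∀ i, WeaklyRegular (E i))
    (ht : {F | ∃ v, IsTop u v ∧ D.ruleAt v = some .cp ∧ F = D.subAt (v ++ [false])}.Finite) :
    WeaklyRegular D := by
  have hU : (⋃ F ∈ Set.range E,
      {G : Coderivation | ∃ v, F.ruleAt v = some .cp ∧ G = F.subAt (v ++ [false])}).Finite :=
    hfin.biUnion (by rintro _ ⟨i, rfl⟩; exact hE i)
  refine (ht.union hU).subset ?_
  rintro F ⟨v, hv, rfl⟩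
  rcases IsTop.cases u v with hT | ⟨i, w, rfl⟩
  · exact Or.inl ⟨v, hT, hv, rfl⟩
  · rw [(h i).ruleAt] at hv
    refine Or.inr (Set.mem_biUnion (Set.mem_range_self i) ⟨w, hv, ?_⟩)
    rw [List.append_assoc, (h i).subAt_append]

end Assembly

/-- The properties shared by the translations of `PLL` and of `nuPLL` derivations. -/
structure TranslationLike (D : Coderivation) : Prop where
  isPLLinf : PLLinf D
  progressing : Progressing D
  finExp : FinExp D
  cpInNwb : CpInNwb D

/-! ## Rules other than promotion -/

section Finitary

variable {D : Coderivation} {ι : Type} {u : ι → Node} {E : ι → Coderivation}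
  {r : RuleName} {Γ : Sequent}

lemma TranslationLike.of_root (h : ∀ i, D.HasSub (u i) (E i)) (hE : ∀ i, TranslationLike (E i))
    (htop : ∀ v, IsTop u v → D.mem v → v = []) (hlab : D.label [] = some (r, Γ))
    (hr : r ∈ pllInfRules) (hcp : r ≠ .cp) (hok : RuleOk r Γ (D.premsAt [])) :
    TranslationLike D := by
  have hbr : ∀ β, InfBranch D β → ¬ ∀ n, IsTop u (brNode β n) := fun β hβ hT => by
    have := congrArg List.length (htop _ (hT 1) (hβ 1))
    simp [length_brNode] at this
  refine ⟨isOver_of_hasSub h (fun i => (hE i).isPLLinf) ?_,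
    progressing_of_hasSub h (fun i => (hE i).progressing) fun β hβ hT => (hbr β hβ hT).elim,
    finExp_of_hasSub h (fun i => (hE i).finExp) fun β hβ hT => (hbr β hβ hT).elim,
    cpInNwb_of_hasSub h (fun i => (hE i).cpInNwb) ?_⟩
  · intro v r' Γ' hT hv
    obtain rfl := htop v hT (by simp [Coderivation.mem, hv])
    rw [hlab] at hv
    obtain ⟨rfl, rfl⟩ : r = r' ∧ Γ = Γ' := by simpa using hv
    exact ⟨hr, hok⟩
  · intro v hT hv
    obtain rfl := htop v hT (by
      obtain ⟨x, hx, -⟩ := Option.map_eq_some_iff.1 hv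
      simp [Coderivation.mem, hx])
    simp [Coderivation.ruleAt, hlab, hcp] at hv

lemma regular_of_root [Finite ι] (h : ∀ i, D.HasSub (u i) (E i)) (hE : ∀ i, Regular (E i))
    (htop : ∀ v, IsTop u v → D.mem v → v = []) : Regular D := by
  refine regular_of_hasSub h (Set.finite_range E) hE
    ((Set.finite_singleton (D.subAt [])).subset ?_)
  rintro F ⟨v, hT, hv, rfl⟩
  rw [htop v hT hv]
  rfl

lemma weaklyRegular_of_root [Finite ι] (h : ∀ i, D.HasSub (u i) (E i))
    (hE : ∀ i, WeaklyRegular (E i)) (htop : ∀ v, IsTop u v → D.mem v → v = []) :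
    WeaklyRegular D := by
  refine weaklyRegular_of_hasSub h (Set.finite_range E) hE
    ((Set.finite_singleton (D.subAt ([] ++ [false]))).subset ?_)
  rintro F ⟨v, hT, hv, rfl⟩
  obtain rfl := htop v hT (by
    obtain ⟨x, hx, -⟩ := Option.map_eq_some_iff.1 hv
    simp [Coderivation.mem, hx])
  rfl

lemma node0_hasSub (i : Empty) : (node0 r Γ).HasSub (i.elim : Node) i.elim := i.elim

lemma node0_top (v : Node) (_ : IsTop (fun i : Empty => (i.elim : Node)) v)
    (hv : (node0 r Γ).mem v) : v = [] := by
  cases v with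
  | nil => rfl
  | cons b v => simp [Coderivation.mem, node0] at hv

lemma node1_hasSub (r : RuleName) (Γ : Sequent) (D : Coderivation) (_ : Unit) :
    (node1 r Γ D).HasSub [false] D := fun _ => rfl

lemma node1_top (v : Node) (hT : IsTop (fun _ : Unit => [false]) v)
    (hv : (node1 r Γ D).mem v) : v = [] := by
  match v with
  | [] => rfl
  | false :: v => exact (hT () v rfl).elim
  | true :: v => simp [Coderivation.mem, node1] at hv

lemma node2_hasSub (r : RuleName) (Γ : Sequent) (D E : Coderivation) (b : Bool) :
    (node2 r Γ D E).HasSub [b] (bif b then E else D) := by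
  intro w
  cases b <;> rfl

lemma node2_top {D E : Coderivation} (v : Node) (hT : IsTop (fun b : Bool => [b]) v)
    (_ : (node2 r Γ D E).mem v) : v = [] := by
  cases v with
  | nil => rfl
  | cons b v => exact (hT b v rfl).elim

lemma node1_premsAt (r : RuleName) (Γ : Sequent) (D : Coderivation) :
    (node1 r Γ D).premsAt [] = [D.conclusion] := by
  have h := (node1_hasSub r Γ D ()).seqAt_root
  simp only [Coderivation.premsAt, List.nil_append, h]
  rfl

lemma node2_premsAt (r : RuleName) (Γ : Sequent) (D E : Coderivation) :
    (node2 r Γ D E).premsAt [] = [D.conclusion, E.conclusion] := by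
  have h₁ := (node2_hasSub r Γ D E false).seqAt_root
  have h₂ := (node2_hasSub r Γ D E true).seqAt_root
  simp only [Coderivation.premsAt, List.nil_append, h₁, h₂]
  rfl

lemma TranslationLike.node0 (hr : r ∈ pllInfRules) (hcp : r ≠ .cp) (hok : RuleOk r Γ []) :
    TranslationLike (node0 r Γ) :=
  .of_root node0_hasSub (fun i => i.elim) node0_top rfl hr hcp hok

lemma TranslationLike.node1 (hD : TranslationLike D) (hr : r ∈ pllInfRules) (hcp : r ≠ .cp)
    (hok : RuleOk r Γ [D.conclusion]) : TranslationLike (node1 r Γ D) :=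
  .of_root (node1_hasSub r Γ D) (fun _ => hD) node1_top rfl hr hcp
    (by rwa [node1_premsAt])

lemma TranslationLike.node2 {D E : Coderivation} (hD : TranslationLike D)
    (hE : TranslationLike E) (hr : r ∈ pllInfRules) (hcp : r ≠ .cp)
    (hok : RuleOk r Γ [D.conclusion, E.conclusion]) : TranslationLike (node2 r Γ D E) :=
  .of_root (node2_hasSub r Γ D E) (fun b => by cases b; exacts [hD, hE]) node2_top rfl hr hcp
    (by rwa [node2_premsAt])

lemma regular_node0 : Regular (node0 r Γ) :=
  regular_of_root node0_hasSub (fun i => i.elim) node0_top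

lemma regular_node1 (hD : Regular D) : Regular (node1 r Γ D) :=
  regular_of_root (node1_hasSub r Γ D) (fun _ => hD) node1_top

lemma regular_node2 {D E : Coderivation} (hD : Regular D) (hE : Regular E) :
    Regular (node2 r Γ D E) :=
  regular_of_root (node2_hasSub r Γ D E) (fun b => by cases b; exacts [hD, hE]) node2_top

lemma weaklyRegular_node0 : WeaklyRegular (node0 r Γ) :=
  weaklyRegular_of_root node0_hasSub (fun i => i.elim) node0_top

lemma weaklyRegular_node1 (hD : WeaklyRegular D) : WeaklyRegular (node1 r Γ D) :=
  weaklyRegular_of_root (node1_hasSub r Γ D) (fun _ => hD) node1_top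

lemma weaklyRegular_node2 {D E : Coderivation} (hD : WeaklyRegular D) (hE : WeaklyRegular E) :
    WeaklyRegular (node2 r Γ D E) :=
  weaklyRegular_of_root (node2_hasSub r Γ D E) (fun b => by cases b; exacts [hD, hE]) node2_top

end Finitary

/-! ## Non-wellfounded boxes -/

section Box

variable {Γ : Sequent} {g : ℕ → Coderivation}

/-- The root of the `n`-th call of a non-wellfounded box. -/
def callNode (n : ℕ) : Node := List.replicate n true ++ [false]

lemma leadSplit_replicate (n : ℕ) : leadSplit (List.replicate n true) = (n, none) := by
  induction n with
  | zero => rfl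
  | succ n ih => simp [List.replicate_succ, leadSplit, ih]

lemma leadSplit_callNode_append (n : ℕ) (w : Node) :
    leadSplit (callNode n ++ w) = (n, some w) := by
  unfold callNode
  induction n with
  | zero => rfl
  | succ n ih =>
    simp only [List.replicate_succ, List.cons_append, leadSplit, ih]

lemma nwbOf_label_replicate (Γ : Sequent) (g : ℕ → Coderivation) (n : ℕ) :
    (nwbOf Γ g).label (List.replicate n true) = some (.cp, Γ) := by
  simp only [nwbOf, leadSplit_replicate]

lemma nwbOf_hasSub (Γ : Sequent) (g : ℕ → Coderivation) (n : ℕ) :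
    (nwbOf Γ g).HasSub (callNode n) (g n) := by
  intro w
  simp only [nwbOf, leadSplit_callNode_append]

lemma IsTop.eq_replicate {v : Node} (h : IsTop callNode v) :
    ∃ n, v = List.replicate n true := by
  induction v with
  | nil => exact ⟨0, rfl⟩
  | cons b v ih =>
    cases b with
    | false => exact (h 0 v rfl).elim
    | true =>
      obtain ⟨n, rfl⟩ := ih fun i w hw => h (i + 1) w (by
        rw [hw]
        simp [callNode, List.replicate_succ])
      exact ⟨n + 1, rfl⟩

lemma nwbOf_seqAt_replicate (Γ : Sequent) (g : ℕ → Coderivation) (n : ℕ) :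
    (nwbOf Γ g).seqAt (List.replicate n true) = some Γ := by
  simp only [Coderivation.seqAt, nwbOf_label_replicate, Option.map_some]

lemma nwbOf_premsAt_replicate (Γ : Sequent) (g : ℕ → Coderivation) (n : ℕ) :
    (nwbOf Γ g).premsAt (List.replicate n true) = [(g n).conclusion, Γ] := by
  have h := (nwbOf_hasSub Γ g n).seqAt_root
  unfold callNode at h
  simp only [Coderivation.premsAt, h, ← List.replicate_succ', nwbOf_seqAt_replicate]
  rfl

lemma isNwbAt_nwbOf (Γ : Sequent) (g : ℕ → Coderivation) : IsNwbAt (nwbOf Γ g) [] := fun n => by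
  simp [Coderivation.ruleAt, nwbOf_label_replicate]

lemma RuleOk.cp_of_fp {P : Sequent} (h : RuleOk .fp Γ [P]) : RuleOk .cp Γ [P, Γ] := by
  obtain ⟨C₀, ps₀, hc, hΓ, hps⟩ := h
  cases hc with
  | fp A Δ =>
    obtain ⟨hP, -⟩ := List.forall₂_cons.1 hps
    exact ⟨_, _, .cp A Δ, hΓ, .cons hP (.cons hΓ .nil)⟩

lemma progThread_nwbOf {P : Sequent} (h : RuleOk .fp Γ [P]) {β : ℕ → Bool}
    (hβ : ∀ n, brNode β n = List.replicate n true) : ProgThread (nwbOf Γ g) β := by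
  obtain ⟨C₀, ps₀, hc, hΓ, -⟩ := h
  cases hc with
  | fp A Δ =>
    obtain ⟨f, hf, hsurj⟩ := PosAlign.exists_of_perm hΓ
    obtain ⟨q, hq, hq0⟩ := hsurj 0 (by simp)
    have hβt : ∀ n, β n = true := fun n => by
      have := hβ (n + 1)
      rw [brNode_succ, hβ, List.replicate_succ'] at this
      simpa using this
    refine ⟨0, fun _ => q, fun i _ => ⟨A, ?_⟩, fun i _ => ?_, fun N => ⟨N, le_rfl, N.zero_le, ?_⟩⟩
    · rw [hβ, Coderivation.formulaAt, nwbOf_seqAt_replicate, Option.bind_some,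
        ← (hf.2.1 q hq).2, hq0]
      rfl
    · rw [hβ, hβt]
      exact ⟨.cp, Γ, Γ, _, _, _, f, f, nwbOf_label_replicate Γ g i,
        by rw [← List.replicate_succ', nwbOf_seqAt_replicate], .cp A Δ, hf, rfl, hf, rfl⟩
    · rw [hβ]
      exact ⟨Γ, _, _, f, nwbOf_label_replicate Γ g N, .cp A Δ, hf, hq0⟩

lemma TranslationLike.nwbOf {P : Sequent} (hg : ∀ i, TranslationLike (g i))
    (hP : ∀ i, (g i).conclusion = P) (hok : RuleOk .fp Γ [P]) :
    TranslationLike (nwbOf Γ g) := by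
  have hbr : ∀ β : ℕ → Bool, (∀ n, IsTop callNode (brNode β n)) →
      ∀ n, brNode β n = List.replicate n true := fun β hT =>
    brNode_eq_replicate fun n => (hT n).eq_replicate
  refine ⟨isOver_of_hasSub (nwbOf_hasSub Γ g) (fun i => (hg i).isPLLinf) ?_,
    progressing_of_hasSub (nwbOf_hasSub Γ g) (fun i => (hg i).progressing)
      fun β _ hT => progThread_nwbOf hok (hbr β hT),
    finExp_of_hasSub (nwbOf_hasSub Γ g) (fun i => (hg i).finExp) fun β _ hT => ?_,
    cpInNwb_of_hasSub (nwbOf_hasSub Γ g) (fun i => (hg i).cpInNwb) ?_⟩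
  · intro v r Δ hT hv
    obtain ⟨n, rfl⟩ := hT.eq_replicate
    rw [nwbOf_label_replicate] at hv
    obtain ⟨rfl, rfl⟩ : RuleName.cp = r ∧ Γ = Δ := by simpa using hv
    rw [nwbOf_premsAt_replicate, hP]
    exact ⟨by simp [pllInfRules], hok.cp_of_fp⟩
  · simp [hbr β hT, Coderivation.ruleAt, nwbOf_label_replicate]
  · intro v hT _
    obtain ⟨n, rfl⟩ := hT.eq_replicate
    exact ⟨[], n, rfl, isNwbAt_nwbOf Γ g⟩

lemma weaklyRegular_nwbOf (hfin : (Set.range g).Finite) (hg : ∀ i, WeaklyRegular (g i)) :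
    WeaklyRegular (nwbOf Γ g) := by
  refine weaklyRegular_of_hasSub (nwbOf_hasSub Γ g) hfin hg (hfin.subset ?_)
  rintro F ⟨v, hT, -, rfl⟩
  obtain ⟨n, rfl⟩ := hT.eq_replicate
  exact ⟨n, (nwbOf_hasSub Γ g n).subAt_eq.symm⟩

lemma nwbOf_const_hasSub (Γ : Sequent) (E : Coderivation) (n : ℕ) :
    (nwbOf Γ fun _ => E).HasSub (List.replicate n true) (nwbOf Γ fun _ => E) := by
  intro w
  induction n with
  | zero => rfl
  | succ n ih =>
    rw [← ih]
    simp [List.replicate_succ, nwbOf, leadSplit]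

lemma regular_nwbOf_const {E : Coderivation} (hE : Regular E) :
    Regular (nwbOf Γ fun _ => E) := by
  refine regular_of_hasSub (nwbOf_hasSub Γ fun _ => E) Set.finite_range_const (fun _ => hE)
    ((Set.finite_singleton (nwbOf Γ fun _ => E)).subset ?_)
  rintro F ⟨v, hT, -, rfl⟩
  obtain ⟨n, rfl⟩ := hT.eq_replicate
  exact (nwbOf_const_hasSub Γ E n).subAt_eq

end Box

/-! ## Translations -/

lemma mem_pllInfRules_of_pllRules {r : RuleName} (hr : r ∈ pllRules) (h : r ≠ .fp) :
    r ∈ pllInfRules ∧ r ≠ .cp := by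
  cases r <;> simp_all [pllRules, pllInfRules]

lemma mem_pllInfRules_of_nupllRules {r : RuleName} (hr : r ∈ nupllRules) :
    r ∈ pllInfRules ∧ r ≠ .cp := by
  cases r <;> simp_all [nupllRules, pllInfRules]

lemma RuleOk.fp_length {Γ : Sequent} {ps : List Sequent} (h : RuleOk .fp Γ ps) :
    ps.length = 1 := by
  obtain ⟨C₀, ps₀, hc, -, hps⟩ := h
  cases hc
  exact hps.length_eq

lemma PDeriv.conclusion_toCo (D : PDeriv) : D.toCo.conclusion = D.concl := by
  cases D with
  | p0 r Γ => rfl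
  | p1 r Γ D =>
    unfold PDeriv.toCo
    split <;> rfl
  | p2 r Γ D E => rfl

lemma NDeriv.conclusion_toCo (D : NDeriv) : D.toCo.conclusion = D.concl := by
  cases D <;> rfl

lemma PValid.translationLike {D : PDeriv} (h : PValid D) :
    TranslationLike D.toCo ∧ Regular D.toCo := by
  induction h with
  | p0 r Γ hr hok =>
    have hfp : r ≠ .fp := by rintro rfl; simpa using hok.fp_length
    obtain ⟨hr, hcp⟩ := mem_pllInfRules_of_pllRules hr hfp
    exact ⟨.node0 hr hcp hok, regular_node0⟩
  | p1 r Γ D hr hok _ ih =>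
    rw [← D.conclusion_toCo] at hok
    unfold PDeriv.toCo
    split
    · subst r
      exact ⟨.nwbOf (fun _ => ih.1) (fun _ => rfl) hok, regular_nwbOf_const ih.2⟩
    · next hfp =>
      obtain ⟨hr, hcp⟩ := mem_pllInfRules_of_pllRules hr hfp
      exact ⟨.node1 ih.1 hr hcp hok, regular_node1 ih.2⟩
  | p2 r Γ D E hr hok _ _ ihD ihE =>
    have hfp : r ≠ .fp := by rintro rfl; simpa using hok.fp_length
    rw [← D.conclusion_toCo, ← E.conclusion_toCo] at hok
    obtain ⟨hr, hcp⟩ := mem_pllInfRules_of_pllRules hr hfp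
    exact ⟨.node2 ihD.1 ihE.1 hr hcp hok, regular_node2 ihD.2 ihE.2⟩

lemma NValid.translationLike {D : NDeriv} (h : NValid D) :
    TranslationLike D.toCo ∧ WeaklyRegular D.toCo := by
  induction h with
  | n0 r Γ hr hok =>
    obtain ⟨hr, hcp⟩ := mem_pllInfRules_of_nupllRules hr
    exact ⟨.node0 hr hcp hok, weaklyRegular_node0⟩
  | n1 r Γ D hr hok _ ih =>
    rw [← D.conclusion_toCo] at hok
    obtain ⟨hr, hcp⟩ := mem_pllInfRules_of_nupllRules hr
    exact ⟨.node1 ih.1 hr hcp hok, weaklyRegular_node1 ih.2⟩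
  | n2 r Γ D E hr hok _ _ ihD ihE =>
    rw [← D.conclusion_toCo, ← E.conclusion_toCo] at hok
    obtain ⟨hr, hcp⟩ := mem_pllInfRules_of_nupllRules hr
    exact ⟨.node2 ihD.1 ihE.1 hr hcp hok, weaklyRegular_node2 ihD.2 ihE.2⟩
  | nup Γ f _ hfin hconcl hok ih =>
    refine ⟨.nwbOf (fun i => (ih i).1) (fun i => ((f i).conclusion_toCo).trans (hconcl i)) hok,
      weaklyRegular_nwbOf ?_ fun i => (ih i).2⟩
    exact (hfin.image NDeriv.toCo).subset (by rintro _ ⟨i, rfl⟩; exact ⟨_, ⟨i, rfl⟩, rfl⟩)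

/-- **Proposition 4.16.1**: the translation of a `PLL` derivation (resp. a
`nuPLL` derivation) is a coderivation of `rPLL∞` (resp. `wrPLL∞`) with the same
conclusion, all of whose `c!p` rules belong to (the main branch of) a
non-wellfounded box. -/
theorem translations_forward :
    (∀ D : PDeriv, PValid D →
      rPLL D.toCo ∧ D.toCo.conclusion = D.concl ∧ CpInNwb D.toCo) ∧
    (∀ D : NDeriv, NValid D →
      wrPLL D.toCo ∧ D.toCo.conclusion = D.concl ∧ CpInNwb D.toCo) := by
  refine ⟨fun D hD => ?_, fun D hD => ?_⟩
  · obtain ⟨h, hreg⟩ := hD.translationLike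
    exact ⟨⟨h.isPLLinf, h.progressing, h.finExp, hreg⟩, D.conclusion_toCo, h.cpInNwb⟩
  · obtain ⟨h, hreg⟩ := hD.translationLike
    exact ⟨⟨h.isPLLinf, h.progressing, h.finExp, hreg⟩, D.conclusion_toCo, h.cpInNwb⟩

end NWPLL
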